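/- arXiv:1502.02625 — 5 statements merged into one kernel-verified Lean document; each statement's English description precedes it below -/
import Mathlib

section
/- If [i_1,…,i_K] and [i'_1,…,i'_K] are stepping sequences for m−1 (so K = 2^{m−1} − m), then the concatenation [i_1+1, i_2+1, …, i_K+1] ++ [1, 2, …, m−1] ++ [i'_1, i'_2, …, i'_K] is a stepping sequence for m. -/
open List

/-- The initial configuration `(1, 2, …, m)`. -/
def initConfig (m : ℕ) : List ℕ := (List.range m).map (· + 1)

/-- A move at index `i` (with `1 ≤ i ≤ m-1`) transposes the entries `q_i` and `q_{i+1}`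
(one-indexed), i.e. the entries at zero-indexed positions `i-1` and `i`. -/
def swapAdj (q : List ℕ) (i : ℕ) : List ℕ :=
  (q.set (i - 1) (q.getD i 0)).set i (q.getD (i - 1) 0)

/-- The prefix set `S_k(q) = {q_1, …, q_k}`. -/
def prefixSet (q : List ℕ) (k : ℕ) : Finset ℕ := (q.take k).toFinset

/-- The initial prefix sets `S_0 ⊂ S_1 ⊂ … ⊂ S_m` of the configuration `(1,…,m)`. -/
def initSets (m : ℕ) : List (Finset ℕ) :=
  (List.range (m + 1)).map (fun k => prefixSet (initConfig m) k)

/-- The sets generated by applying a sequence of moves starting from configuration `q`: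
the `t`-th generated set is the prefix set of length `i_t` of the configuration
obtained after the `t`-th move. -/
def genSetsAux (q : List ℕ) : List ℕ → List (Finset ℕ)
  | [] => []
  | i :: rest => prefixSet (swapAdj q i) i :: genSetsAux (swapAdj q i) rest

/-- The sets generated by the moves, starting from the initial configuration `(1,…,m)`. -/
def genSets (m : ℕ) (moves : List ℕ) : List (Finset ℕ) :=
  genSetsAux (initConfig m) moves

/-- `moves` is a stepping sequence for `m`: each move index lies in `{1,…,m-1}`, and the
initial prefix sets `S_0,…,S_m` together with the generated sets list every subset of
`{1,…,m}` exactly once. -/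
def IsSteppingSeq (m : ℕ) (moves : List ℕ) : Prop :=
  (∀ i ∈ moves, 1 ≤ i ∧ i ≤ m - 1) ∧
  (initSets m ++ genSets m moves).Perm (Finset.Icc 1 m).powerset.toList

lemma length_swapAdj (q : List ℕ) (i : ℕ) : (swapAdj q i).length = q.length := by
  simp [swapAdj]

lemma swapAdj_cons (a : ℕ) (q : List ℕ) {i : ℕ} (hi : 1 ≤ i) :
    swapAdj (a :: q) (i + 1) = a :: swapAdj q i := by
  obtain ⟨j, rfl⟩ := Nat.exists_eq_add_of_le' hi
  simp [swapAdj]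

lemma swapAdj_one (a b : ℕ) (q : List ℕ) : swapAdj (a :: b :: q) 1 = b :: a :: q := by
  simp [swapAdj]

lemma swapAdj_append (q s : List ℕ) {i : ℕ} (hi : i < q.length) :
    swapAdj (q ++ s) i = swapAdj q i ++ s := by
  have h : i - 1 < q.length := by omega
  simp only [swapAdj, List.getD_append _ _ _ _ hi, List.getD_append _ _ _ _ h]
  simp [hi, h]

lemma swapAdj_map (f : ℕ → ℕ) (q : List ℕ) {i : ℕ} (hi : i < q.length) :
    swapAdj (q.map f) i = (swapAdj q i).map f := by
  have h : i - 1 < q.length := by omega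
  simp [swapAdj, hi, h, List.map_set]

lemma swapAdj_perm (q : List ℕ) {i : ℕ} (h1 : 1 ≤ i) (hi : i < q.length) :
    (swapAdj q i).Perm q := by
  induction q generalizing i with
  | nil => simp at hi
  | cons a q ih =>
    obtain ⟨j, rfl⟩ := Nat.exists_eq_add_of_le' h1
    rcases j with _ | j
    · rcases q with _ | ⟨b, q⟩
      · simp at hi
      · rw [swapAdj_one]
        exact List.Perm.swap a b q
    · rw [swapAdj_cons a q (by omega)]
      exact (ih (by omega) (by simpa using hi)).cons a

lemma prefixSet_zero (q : List ℕ) : prefixSet q 0 = ∅ := by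
  simp [prefixSet]

lemma prefixSet_cons (a : ℕ) (q : List ℕ) (k : ℕ) :
    prefixSet (a :: q) (k + 1) = insert a (prefixSet q k) := by
  simp [prefixSet]

lemma prefixSet_append (q s : List ℕ) {k : ℕ} (hk : k ≤ q.length) :
    prefixSet (q ++ s) k = prefixSet q k := by
  simp [prefixSet, List.take_append_of_le_length hk]

lemma prefixSet_map (f : ℕ → ℕ) (q : List ℕ) (k : ℕ) :
    prefixSet (q.map f) k = (prefixSet q k).image f := by
  ext x
  simp [prefixSet, ← List.map_take]

/-- The configuration reached from `q` by applying a sequence of moves. -/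
def runMoves (q moves : List ℕ) : List ℕ := moves.foldl swapAdj q

lemma genSetsAux_append (q M N : List ℕ) :
    genSetsAux q (M ++ N) = genSetsAux q M ++ genSetsAux (runMoves q M) N := by
  induction M generalizing q with
  | nil => simp [genSetsAux, runMoves]
  | cons i M ih => simp [genSetsAux, runMoves, ih]

lemma runMoves_cons_map_succ (a : ℕ) (q M : List ℕ) (hM : ∀ i ∈ M, 1 ≤ i) :
    runMoves (a :: q) (M.map (· + 1)) = a :: runMoves q M := by
  induction M generalizing q with
  | nil => simp [runMoves]
  | cons i M ih =>
    simp only [List.forall_mem_cons] at hM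
    have := ih (swapAdj q i) hM.2
    simpa [runMoves, swapAdj_cons a q hM.1] using this

lemma genSetsAux_cons_map_succ (a : ℕ) (q M : List ℕ) (hM : ∀ i ∈ M, 1 ≤ i) :
    genSetsAux (a :: q) (M.map (· + 1)) = (genSetsAux q M).map (insert a) := by
  induction M generalizing q with
  | nil => simp [genSetsAux]
  | cons i M ih =>
    simp only [List.forall_mem_cons] at hM
    simp [genSetsAux, swapAdj_cons a q hM.1, prefixSet_cons, ih _ hM.2]

lemma genSetsAux_append_config (q s M : List ℕ) (hM : ∀ i ∈ M, i < q.length) :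
    genSetsAux (q ++ s) M = genSetsAux q M := by
  induction M generalizing q with
  | nil => simp [genSetsAux]
  | cons i M ih =>
    simp only [List.forall_mem_cons] at hM
    have hl := length_swapAdj q i
    simp only [genSetsAux, swapAdj_append q s hM.1]
    rw [prefixSet_append _ _ (by omega), ih _ (by rw [hl]; exact hM.2)]

lemma genSetsAux_map (f : ℕ → ℕ) (q M : List ℕ) (hM : ∀ i ∈ M, i < q.length) :
    genSetsAux (q.map f) M = (genSetsAux q M).map (Finset.image f) := by
  induction M generalizing q with
  | nil => simp [genSetsAux]
  | cons i M ih =>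
    simp only [List.forall_mem_cons] at hM
    have hl := length_swapAdj q i
    simp only [genSetsAux, swapAdj_map f q hM.1, List.map_cons]
    rw [prefixSet_map, ih _ (by rw [hl]; exact hM.2)]

lemma runMoves_map (f : ℕ → ℕ) (q M : List ℕ) (hM : ∀ i ∈ M, i < q.length) :
    runMoves (q.map f) M = (runMoves q M).map f := by
  induction M generalizing q with
  | nil => simp [runMoves]
  | cons i M ih =>
    simp only [List.forall_mem_cons] at hM
    have := ih (swapAdj q i) (by rw [length_swapAdj]; exact hM.2)
    simpa [runMoves, swapAdj_map f q hM.1] using this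

lemma runMoves_perm (q M : List ℕ) (hM : ∀ i ∈ M, 1 ≤ i ∧ i < q.length) :
    (runMoves q M).Perm q := by
  induction M generalizing q with
  | nil => simp [runMoves]
  | cons i M ih =>
    simp only [List.forall_mem_cons] at hM
    have hl := length_swapAdj q i
    have := ih (swapAdj q i) (by rw [hl]; exact hM.2)
    exact this.trans (swapAdj_perm q hM.1.1 hM.1.2)

lemma range_succ_map_succ (n : ℕ) :
    (List.range (n + 1)).map (· + 1) = 1 :: ((List.range n).map (· + 1)).map (· + 1) := by
  simp [List.range_succ_eq_map, Function.comp_def]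

lemma runMoves_sweep (a : ℕ) (r : List ℕ) :
    runMoves (a :: r) ((List.range r.length).map (· + 1)) = r ++ [a] := by
  induction r with
  | nil => simp [runMoves]
  | cons b r ih =>
    have h := runMoves_cons_map_succ b (a :: r) ((List.range r.length).map (· + 1)) (by simp)
    rw [ih] at h
    rw [List.length_cons, range_succ_map_succ]
    simpa [runMoves, swapAdj_one] using h

lemma genSetsAux_sweep (a : ℕ) (r : List ℕ) :
    genSetsAux (a :: r) ((List.range r.length).map (· + 1)) =
      (List.range r.length).map (fun k => prefixSet r (k + 1)) := by
  induction r with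
  | nil => simp [genSetsAux]
  | cons b r ih =>
    have h := genSetsAux_cons_map_succ b (a :: r) ((List.range r.length).map (· + 1)) (by simp)
    rw [ih] at h
    rw [List.length_cons, range_succ_map_succ]
    simp only [genSetsAux, swapAdj_one, h]
    simp [List.range_succ_eq_map, prefixSet_cons, prefixSet_zero, Function.comp_def]

lemma length_initConfig (n : ℕ) : (initConfig n).length = n := by
  simp [initConfig]

lemma initConfig_succ (n : ℕ) : initConfig (n + 1) = 1 :: (initConfig n).map (· + 1) :=
  range_succ_map_succ n

lemma nodup_initConfig (n : ℕ) : (initConfig n).Nodup :=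
  List.nodup_range.map (add_left_injective 1)

lemma mem_initConfig {n x : ℕ} : x ∈ initConfig n ↔ 1 ≤ x ∧ x ≤ n := by
  simp only [initConfig, List.mem_map, List.mem_range]
  constructor
  · rintro ⟨y, hy, rfl⟩
    omega
  · rintro ⟨h1, h2⟩
    exact ⟨x - 1, by omega, by omega⟩

lemma initSets_succ (n : ℕ) :
    initSets (n + 1) =
      ∅ :: (initSets n).map (fun s => insert 1 (s.image (· + 1))) := by
  rw [initSets, List.range_succ_eq_map]
  simp [initSets, initConfig_succ, prefixSet_cons, prefixSet_zero, prefixSet_map,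
    Function.comp_def]

/-- Every configuration is a relabelling of the initial one. -/
lemma map_initConfig_getD (r : List ℕ) :
    (initConfig r.length).map (fun k => r.getD (k - 1) 0) = r := by
  apply List.ext_getElem <;> simp +contextual [initConfig]

/-- The subsets of `{1,…,n+1}` are those containing `1` and those contained in `{2,…,n+1}`,
each family being parametrised by the subsets of `{1,…,n}`. -/
lemma powerset_toList_perm (n : ℕ) (f : ℕ → ℕ)
    (hf : Set.InjOn f (Finset.Icc 1 n)) (him : (Finset.Icc 1 n).image f = Finset.Icc 2 (n + 1)) :
    ((Finset.Icc 1 n).powerset.toList.map (fun s : Finset ℕ => insert 1 (s.image (· + 1))) ++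
      (Finset.Icc 1 n).powerset.toList.map (Finset.image f)).Perm
      (Finset.Icc 1 (n + 1)).powerset.toList := by
  have hsucc : (Finset.Icc 1 n).image (· + 1) = Finset.Icc 2 (n + 1) := by
    simp [Finset.image_add_right_Icc]
  have hnot : ∀ g : ℕ → ℕ, (Finset.Icc 1 n).image g = Finset.Icc 2 (n + 1) →
      ∀ s ⊆ Finset.Icc 1 n, 1 ∉ s.image g := by
    intro g hg s hs h1
    have := Finset.image_subset_image (f := g) hs h1
    simp [hg] at this
  rw [List.perm_ext_iff_of_nodup _ (Finset.nodup_toList _)]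
  · intro t
    have hIcc : Finset.Icc 1 (n + 1) = insert 1 (Finset.Icc 2 (n + 1)) := by
      ext x
      simp only [Finset.mem_insert, Finset.mem_Icc]
      omega
    simp only [List.mem_append, List.mem_map, Finset.mem_toList, Finset.mem_powerset]
    constructor
    · rintro (⟨s, hs, rfl⟩ | ⟨s, hs, rfl⟩)
      · rw [hIcc, ← hsucc]
        exact Finset.insert_subset_insert _ (Finset.image_subset_image hs)
      · rw [hIcc, ← him]
        exact (Finset.image_subset_image hs).trans (Finset.subset_insert _ _)
    · intro ht
      rw [hIcc] at ht
      by_cases h1 : 1 ∈ t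
      · left
        have := Finset.subset_insert_iff.mp ht
        rw [← hsucc, Finset.subset_image_iff] at this
        obtain ⟨s, hs, hst⟩ := this
        refine ⟨s, by exact_mod_cast hs, ?_⟩
        rw [hst, Finset.insert_erase h1]
      · right
        rw [Finset.subset_insert_iff_of_notMem h1, ← him, Finset.subset_image_iff] at ht
        obtain ⟨s, hs, hst⟩ := ht
        exact ⟨s, by exact_mod_cast hs, hst⟩
  · rw [List.nodup_append']
    refine ⟨List.Nodup.map_on ?_ (Finset.nodup_toList _),
      List.Nodup.map_on ?_ (Finset.nodup_toList _), ?_⟩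
    · intro s hs t ht hst
      rw [Finset.mem_toList, Finset.mem_powerset] at hs ht
      have h := congrArg (fun u => Finset.erase u 1) hst
      beta_reduce at h
      rw [Finset.erase_insert (hnot _ hsucc s hs),
        Finset.erase_insert (hnot _ hsucc t ht)] at h
      exact Finset.image_injective (add_left_injective 1) h
    · intro s hs t ht hst
      rw [Finset.mem_toList, Finset.mem_powerset] at hs ht
      have := congrArg (fun u : Finset ℕ => (u : Set ℕ)) hst
      simp only [Finset.coe_image] at this
      exact_mod_cast (hf.image_eq_image_iff (by exact_mod_cast hs)
        (by exact_mod_cast ht)).mp this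
    · rw [List.disjoint_left]
      simp only [List.mem_map, Finset.mem_toList, Finset.mem_powerset]
      rintro _ ⟨s, hs, rfl⟩ ⟨t, ht, hst⟩
      exact hnot f him t ht (hst ▸ Finset.mem_insert_self _ _)

/-- Theorem 2.1, first recursion: if `A` and `B` are stepping sequences for `m-1`, then
`(A+1) ++ [1,2,…,m-1] ++ B` is a stepping sequence for `m`. -/
theorem stepping_recursion_one (m : ℕ) (hm : 3 ≤ m) (A B : List ℕ)
    (hA : IsSteppingSeq (m - 1) A) (hB : IsSteppingSeq (m - 1) B) :
    IsSteppingSeq m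
      (A.map (· + 1) ++ (List.range (m - 1)).map (· + 1) ++ B) := by
  obtain ⟨n, rfl⟩ : ∃ n, m = n + 1 := ⟨m - 1, by omega⟩
  simp only [Nat.add_sub_cancel] at hA hB ⊢
  obtain ⟨hA1, hA2⟩ := hA
  obtain ⟨hB1, hB2⟩ := hB
  refine ⟨?_, ?_⟩
  · simp only [List.mem_append, List.mem_map, List.mem_range]
    rintro i ((⟨j, hj, rfl⟩ | ⟨j, hj, rfl⟩) | hi)
    · have := hA1 j hj
      omega
    · omega
    · have := hB1 i hi
      omega
  obtain ⟨r, hr⟩ : ∃ r, r = (runMoves (initConfig n) A).map (· + 1) := ⟨_, rfl⟩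
  have hperm : r.Perm ((initConfig n).map (· + 1)) := by
    rw [hr]
    refine (runMoves_perm _ _ fun i hi => ?_).map _
    have := hA1 i hi
    rw [length_initConfig]
    omega
  have hlen : r.length = n := by rw [hperm.length_eq, List.length_map, length_initConfig]
  obtain ⟨f, hf⟩ : ∃ f : ℕ → ℕ, (initConfig n).map f = r :=
    ⟨fun k => r.getD (k - 1) 0, by rw [← hlen]; exact map_initConfig_getD r⟩
  have hrun : runMoves (initConfig (n + 1)) (A.map (· + 1)) = 1 :: r := by
    rw [initConfig_succ, runMoves_cons_map_succ _ _ _ fun i hi => (hA1 i hi).1, hr,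
      runMoves_map]
    intro i hi
    have := hA1 i hi
    rw [length_initConfig]
    omega
  have hgen : genSets (n + 1) (A.map (· + 1) ++ (List.range n).map (· + 1) ++ B) =
      (genSets n A).map (fun s => insert 1 (s.image (· + 1))) ++
        ((List.range n).map (fun k => prefixSet r (k + 1)) ++
          (genSets n B).map (Finset.image f)) := by
    rw [genSets, List.append_assoc, genSetsAux_append, genSetsAux_append, hrun]
    congr 1
    · rw [initConfig_succ, genSetsAux_cons_map_succ _ _ _ fun i hi => (hA1 i hi).1,
        genSetsAux_map, List.map_map]
      · rfl
      · intro i hi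
        have := hA1 i hi
        rw [length_initConfig]
        omega
    · have h1 := runMoves_sweep 1 r
      have h2 := genSetsAux_sweep 1 r
      rw [hlen] at h1 h2
      rw [h1, h2, genSetsAux_append_config, ← hf, genSetsAux_map]
      · rfl
      all_goals
        intro i hi
        have := hB1 i hi
        simp only [length_initConfig, hlen]
        omega
  have hprefix : ∅ :: (List.range n).map (fun k => prefixSet r (k + 1)) =
      (initSets n).map (Finset.image f) := by
    rw [initSets, List.map_map, ← hf, List.range_succ_eq_map]
    simp [prefixSet_map, prefixSet_zero, Function.comp_def]
  have hinj : Set.InjOn f (Finset.Icc 1 n) := by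
    have hnd : ((initConfig n).map f).Nodup := by
      rw [hf, hperm.nodup_iff]
      exact (nodup_initConfig n).map (add_left_injective 1)
    intro x hx y hy hxy
    rw [Finset.mem_coe, Finset.mem_Icc] at hx hy
    exact List.inj_on_of_nodup_map hnd (mem_initConfig.mpr hx) (mem_initConfig.mpr hy) hxy
  have himage : (Finset.Icc 1 n).image f = Finset.Icc 2 (n + 1) := by
    ext x
    have h : x ∈ (initConfig n).map f ↔ x ∈ (initConfig n).map (· + 1) := by
      rw [hf]
      exact hperm.mem_iff
    have h' : x ∈ (Finset.Icc 1 n).image f ↔ x ∈ (initConfig n).map f := by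
      simp [mem_initConfig]
    rw [h', h, List.mem_map, Finset.mem_Icc]
    constructor
    · rintro ⟨y, hy, rfl⟩
      have := mem_initConfig.mp hy
      omega
    · intro hx
      exact ⟨x - 1, mem_initConfig.mpr (by omega), by omega⟩
  refine List.Perm.trans ?_ (powerset_toList_perm n f hinj himage)
  refine List.Perm.trans ?_ ((hA2.map _).append (hB2.map _))
  rw [hgen, initSets_succ, List.map_append, List.map_append, ← hprefix]
  rw [List.perm_iff_count]
  intro t
  simp only [List.cons_append, List.count_append, List.count_cons]
  omega
end

section
/- For every m ≥ 2, the reverse of the sequence R_m equals its complement; equivalently, for every position i, the sum of the i-th entry of R_m and the i-th entry of the reverse of R_m equals m. -/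
open List

/-- `R_2 = [1]` and `R_m = (R_{m-1}+1) ++ [1,2,…,m-1] ++ R_{m-1}` for `m ≥ 3`. -/
def Rseq : ℕ → List ℕ
  | 0 => []
  | 1 => []
  | 2 => [1]
  | m + 3 => (Rseq (m + 2)).map (· + 1) ++ (List.range (m + 2)).map (· + 1) ++ Rseq (m + 2)

theorem le_of_mem_Rseq {m i : ℕ} (hi : i ∈ Rseq m) : i ≤ m := by
  induction m using Rseq.induct generalizing i with
  | case1 => simp [Rseq] at hi
  | case2 => simp [Rseq] at hi
  | case3 => simp [Rseq] at hi; omega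
  | case4 m ih =>
    simp only [Rseq, mem_append, mem_map, mem_range] at hi
    rcases hi with (⟨j, hj, rfl⟩ | ⟨j, hj, rfl⟩) | hj
    · have := ih hj
      omega
    · omega
    · have := ih hj
      omega

theorem reverse_map_succ_range (n : ℕ) :
    ((List.range n).map (· + 1)).reverse =
      ((List.range n).map (· + 1)).map (fun i => n + 1 - i) := by
  apply List.ext_getElem
  · simp
  · intro t h₁ h₂
    simp at h₁ h₂ ⊢
    omega

theorem reverse_Rseq (m : ℕ) : (Rseq m).reverse = (Rseq m).map (fun i => m - i) := by
  induction m using Rseq.induct with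
  | case1 => simp [Rseq]
  | case2 => simp [Rseq]
  | case3 => simp [Rseq]
  | case4 m ih =>
    have hshift : (Rseq (m + 2)).map (fun i => m + 3 - i) =
        ((Rseq (m + 2)).map (fun i => m + 2 - i)).map (· + 1) := by
      rw [map_map]
      refine map_congr_left fun i hi => ?_
      have := le_of_mem_Rseq hi
      simp only [Function.comp_apply]
      omega
    have hcancel : ((Rseq (m + 2)).map (· + 1)).map (fun i => m + 3 - i) =
        (Rseq (m + 2)).map (fun i => m + 2 - i) := by
      rw [map_map]
      refine map_congr_left fun i _ => ?_
      simp only [Function.comp_apply]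
      omega
    rw [Rseq, reverse_append, reverse_append, map_append, map_append, hshift, hcancel,
      reverse_map_succ_range, ← map_reverse, ih, append_assoc]

/-- Lemma 2.2: the reverse of `R_m` equals its complement `[m - i₁, …, m - i_N]`;
equivalently, corresponding entries of `R_m` and of its reverse sum to `m`. -/
theorem Rseq_reverse_eq_complement (m : ℕ) (hm : 2 ≤ m) :
    (Rseq m).reverse = (Rseq m).map (fun i => m - i) ∧
    ∀ t, t < (Rseq m).length →
      (Rseq m).getD t 0 + (Rseq m).reverse.getD t 0 = m := by
  refine ⟨reverse_Rseq m, fun t ht => ?_⟩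
  have hle := le_of_mem_Rseq (getElem_mem ht)
  rw [reverse_Rseq, getD_eq_getElem _ _ ht, getD_eq_getElem _ _ (by simpa using ht), getElem_map]
  omega
end

section
/- For every m ≥ 2, the greedy method produces exactly the sequence R_m; that is, the sequence of indices selected by the greedy process equals R_m. -/
open List

/-- One run of the greedy method: repeatedly perform the move at the largest index
`i ∈ {1,…,m-1}` such that the set generated by that move has not been seen before,
recording the chosen indices. -/
def greedyAux (m : ℕ) : ℕ → List ℕ → Finset (Finset ℕ) → List ℕ
  | 0, _, _ => []
  | fuel + 1, q, seen =>
    let J := (Finset.Icc 1 (m - 1)).filter (fun i => prefixSet (swapAdj q i) i ∉ seen)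
    if h : J.Nonempty then
      let j := J.max' h
      j :: greedyAux m fuel (swapAdj q j) (insert (prefixSet (swapAdj q j) j) seen)
    else []

/-- The greedy sequence for `m`: start from the configuration `(1,…,m)` with the initial
prefix sets marked as seen; the fuel `2^m` never runs out since at most `2^m - m - 1`
moves are possible. -/
def greedySeq (m : ℕ) : List ℕ :=
  greedyAux m (2 ^ m) (initConfig m) (initSets m).toFinset

lemma greedyAux_step {m f j : ℕ} {q : List ℕ} {seen : Finset (Finset ℕ)}
    (h1 : 1 ≤ j) (hm : j < m) (hj : prefixSet (swapAdj q j) j ∉ seen)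
    (hb : ∀ i, j < i → i < m → prefixSet (swapAdj q i) i ∈ seen) :
    greedyAux m (f + 1) q seen =
      j :: greedyAux m f (swapAdj q j) (insert (prefixSet (swapAdj q j) j) seen) := by
  have hmem : j ∈ (Finset.Icc 1 (m - 1)).filter
      (fun i => prefixSet (swapAdj q i) i ∉ seen) := by
    simp only [Finset.mem_filter, Finset.mem_Icc]
    exact ⟨⟨h1, by omega⟩, hj⟩
  have hmax : ((Finset.Icc 1 (m - 1)).filter
      (fun i => prefixSet (swapAdj q i) i ∉ seen)).max' ⟨j, hmem⟩ = j := by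
    refine le_antisymm (Finset.max'_le _ _ _ fun i hi => ?_) (Finset.le_max' _ _ hmem)
    simp only [Finset.mem_filter, Finset.mem_Icc] at hi
    by_contra hlt
    exact hi.2 (hb i (by omega) (by omega))
  rw [greedyAux]
  simp only [dif_pos (show Finset.Nonempty _ from ⟨j, hmem⟩), hmax]

lemma greedyAux_eq_nil {m f : ℕ} {q : List ℕ} {seen : Finset (Finset ℕ)}
    (hb : ∀ i, 1 ≤ i → i < m → prefixSet (swapAdj q i) i ∈ seen) :
    greedyAux m f q seen = [] := by
  cases f with
  | zero => rfl
  | succ f =>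
    rw [greedyAux]
    refine dif_neg ?_
    rintro ⟨i, hi⟩
    simp only [Finset.mem_filter, Finset.mem_Icc] at hi
    exact hi.2 (hb i (by omega) (by omega))

lemma swapAdj_append_cons_cons (A B : List ℕ) (x y : ℕ) :
    swapAdj (A ++ x :: y :: B) (A.length + 1) = A ++ y :: x :: B := by
  simp [swapAdj, List.getD_eq_getElem?_getD]

lemma prefixSet_append_s7 (A B : List ℕ) : prefixSet (A ++ B) A.length = A.toFinset := by
  simp [prefixSet]

lemma prefixSet_swapAdj (A B : List ℕ) (x y : ℕ) :
    prefixSet (swapAdj (A ++ x :: y :: B) (A.length + 1)) (A.length + 1) =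
      A.toFinset ∪ {y} := by
  rw [swapAdj_append_cons_cons]
  have := prefixSet_append_s7 (A ++ [y]) (x :: B)
  simpa using this

lemma exists_eq_append_cons_cons {α : Type*} (l : List α) {i : ℕ} (h1 : 1 ≤ i)
    (h : i < l.length) :
    ∃ A x y B, l = A ++ x :: y :: B ∧ A.length + 1 = i := by
  refine ⟨l.take (i - 1), l[i - 1], l[i], l.drop (i + 1), ?_, ?_⟩
  · conv_lhs => rw [← List.take_append_drop (i - 1) l]
    rw [List.drop_eq_getElem_cons (by omega)]
    have : i - 1 + 1 = i := by omega
    simp only [this]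
    rw [List.drop_eq_getElem_cons h]
  · rw [List.length_take]; omega

/-- The greedy method carries `x` to the right through the block `b` as long as every set
containing `x` is blocked and the sets avoiding `x` along the way are new. -/
lemma greedyAux_sweep (m x f : ℕ) (S : List ℕ) : ∀ (b A : List ℕ) (seen : Finset (Finset ℕ)),
    (A ++ x :: b ++ S).Nodup → (A ++ x :: b ++ S).length = m →
    (∀ T ⊆ b.toFinset, A.toFinset ∪ insert x T ∈ seen) →
    (∀ b₁ b₂ i, b = b₁ ++ b₂ → A.length + b.length + 1 ≤ i → i < m →
      prefixSet (swapAdj (A ++ b₁ ++ x :: b₂ ++ S) i) i ∈ seen) →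
    (∀ c, c <+: b → c ≠ [] → A.toFinset ∪ c.toFinset ∉ seen) →
    ∃ seen' : Finset (Finset ℕ), greedyAux m (b.length + f) (A ++ x :: b ++ S) seen =
        (List.range b.length).map (· + 1 + A.length) ++
          greedyAux m f (A ++ b ++ x :: S) seen' ∧
      ∀ U, U ∈ seen' ↔
        U ∈ seen ∨ ∃ c, c <+: b ∧ c ≠ [] ∧ U = A.toFinset ∪ c.toFinset := by
  intro b
  induction b with
  | nil =>
    intro A seen _ _ _ _ _
    refine ⟨seen, by simp, fun U => ?_⟩
    simp only [List.prefix_nil]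
    grind
  | cons y b ih =>
    intro A seen hnd hlen hx hout hnew
    have hset : prefixSet (swapAdj (A ++ x :: (y :: b) ++ S) (A.length + 1)) (A.length + 1) =
        A.toFinset ∪ {y} := by
      simpa using prefixSet_swapAdj A (b ++ S) x y
    have hconf : swapAdj (A ++ x :: (y :: b) ++ S) (A.length + 1) =
        (A ++ [y]) ++ x :: b ++ S := by
      simpa using swapAdj_append_cons_cons A (b ++ S) x y
    have hlen' : A.length + b.length + 2 + S.length = m := by
      rw [← hlen]; simp; omega
    have hstep := greedyAux_step (m := m) (f := b.length + f) (j := A.length + 1)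
      (q := A ++ x :: (y :: b) ++ S) (seen := seen) (by omega) (by omega)
      (by
        rw [hset]
        have := hnew [y] ⟨b, rfl⟩ (by simp)
        simpa using this)
      (by
        intro i hi him
        by_cases hi' : A.length + (y :: b).length + 1 ≤ i
        · simpa using hout [] (y :: b) i rfl hi' him
        · obtain ⟨C, u, v, D, hC, hCl⟩ := exists_eq_append_cons_cons (y :: b)
            (i := i - A.length - 1) (by omega) (by simp at hi' ⊢; omega)
          have key := prefixSet_swapAdj (A ++ x :: C) (D ++ S) u v
          have hl : (A ++ x :: C).length + 1 = i := by simp; omega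
          rw [hl] at key
          have hq : A ++ x :: (y :: b) ++ S = (A ++ x :: C) ++ u :: v :: (D ++ S) := by
            rw [hC]; simp
          rw [hq, key]
          have := hx (C.toFinset ∪ {v}) (by
            rw [hC]
            intro z
            simp
            tauto)
          convert this using 1
          ext z
          simp)
    rw [hset, hconf] at hstep
    have hpre : ∀ c, (∃ c', c' <+: b ∧ c = y :: c') ↔ (c <+: y :: b ∧ c ≠ []) := by
      intro c
      cases c with
      | nil => simp
      | cons z c => simp [List.cons_prefix_cons]; tauto
    obtain ⟨seen', hs, hU⟩ := ih (A ++ [y]) (insert (A.toFinset ∪ {y}) seen)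
      (by
        refine (List.Perm.nodup_iff ?_).1 hnd
        simp only [List.append_assoc, List.cons_append, List.nil_append]
        exact List.Perm.append_left A (List.Perm.swap _ _ _))
      (by simp; omega)
      (by
        intro T hT
        refine Finset.mem_insert_of_mem ?_
        have := hx (insert y T) (by
          rw [List.toFinset_cons]; exact Finset.insert_subset_insert _ hT)
        convert this using 1
        ext z
        simp)
      (by
        intro b₁ b₂ i hb hi him
        refine Finset.mem_insert_of_mem ?_
        have := hout (y :: b₁) b₂ i (by simp [hb]) (by simp at hi ⊢; omega) him
        simpa using this)
      (by
        intro c hc hne hmem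
        have hyA : y ∉ A ∧ y ∉ b := by
          simp [List.nodup_append] at hnd
          grind
        have hnd' : ∀ z ∈ c, z ∉ A ∧ z ≠ y := by
          intro z hz
          have hzb := hc.subset hz
          refine ⟨?_, fun h => hyA.2 (h ▸ hzb)⟩
          simp [List.nodup_append] at hnd
          grind
        rcases Finset.mem_insert.1 hmem with h | h
        · obtain ⟨z, hz⟩ := List.exists_mem_of_ne_nil c hne
          have hzz : z ∈ (A ++ [y]).toFinset ∪ c.toFinset := by simp [hz]
          rw [h] at hzz
          have := hnd' z hz
          simp at hzz
          tauto
        · refine hnew (y :: c) (List.cons_prefix_cons.2 ⟨rfl, hc⟩) (by simp) ?_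
          convert h using 1
          ext z
          simp)
    refine ⟨seen', ?_, fun U => ?_⟩
    · have : (y :: b).length + f = b.length + f + 1 := by simp; omega
      rw [this, hstep, hs, List.length_cons, List.range_succ_eq_map]
      simp
      refine ⟨by omega, fun a _ => by omega⟩
    · rw [hU, Finset.mem_insert]
      have hc : ∀ c : List ℕ, (A ++ [y]).toFinset ∪ c.toFinset =
          A.toFinset ∪ (y :: c).toFinset := by
        intro c; ext z; simp
      constructor
      · rintro ((h | h) | ⟨c, hcb, _, h⟩)
        · exact Or.inr ⟨[y], ⟨b, rfl⟩, by simp, by simpa using h⟩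
        · exact Or.inl h
        · exact Or.inr ⟨y :: c, List.cons_prefix_cons.2 ⟨rfl, hcb⟩, by simp, by rw [h, hc]⟩
      · rintro (h | ⟨c, hcb, hne, h⟩)
        · exact Or.inl (Or.inr h)
        · obtain ⟨c', hc', rfl⟩ := (hpre c).2 ⟨hcb, hne⟩
          by_cases hn : c' = []
          · subst hn
            exact Or.inl (Or.inl (by simpa using h))
          · exact Or.inr ⟨c', hc', hn, by rw [h, hc]⟩

lemma Rseq_add_two (n : ℕ) : Rseq (n + 2) =
    (Rseq (n + 1)).map (· + 1) ++ (List.range (n + 1)).map (· + 1) ++ Rseq (n + 1) := by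
  cases n with
  | zero => rfl
  | succ n => rfl

/-- If the only sets `P ∪ T` with `T ⊆ q` seen so far are the prefix sets of the current
configuration and the moves to the right of the window `q` are all blocked, then the greedy
method performs a shifted copy of `Rseq` inside the window and sees all sets `P ∪ T`. -/
lemma greedyAux_window (m : ℕ) : ∀ (n f : ℕ) (P q S : List ℕ) (seen : Finset (Finset ℕ)),
    q.length = n + 1 → (P ++ q ++ S).Nodup → (P ++ q ++ S).length = m →
    (∀ q' i, q'.Perm q → P.length + q.length ≤ i → i < m →
      prefixSet (swapAdj (P ++ q' ++ S) i) i ∈ seen) →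
    (∀ T ⊆ q.toFinset,
      (P.toFinset ∪ T ∈ seen ↔ ∃ c, c <+: q ∧ T = c.toFinset)) →
    ∃ (q' : List ℕ) (seen' : Finset (Finset ℕ)), q'.Perm q ∧
      greedyAux m ((Rseq (n + 1)).length + f) (P ++ q ++ S) seen =
        (Rseq (n + 1)).map (· + P.length) ++ greedyAux m f (P ++ q' ++ S) seen' ∧
      ∀ U, U ∈ seen' ↔ U ∈ seen ∨ ∃ T ⊆ q.toFinset, U = P.toFinset ∪ T := by
  intro n
  induction n with
  | zero =>
    intro f P q S seen hq hnd hlen hout hfresh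
    obtain ⟨x, rfl⟩ := List.length_eq_one_iff.1 hq
    refine ⟨[x], seen, List.Perm.refl _, by simp [Rseq], fun U => ?_⟩
    refine ⟨Or.inl, ?_⟩
    rintro (h | ⟨T, hT, rfl⟩)
    · exact h
    · refine (hfresh T hT).2 ?_
      rcases Finset.subset_singleton_iff.1 (by simpa using hT) with rfl | rfl
      · exact ⟨[], by simp, by simp⟩
      · exact ⟨[x], List.prefix_rfl, by simp⟩
  | succ n ih =>
    intro f P q S seen hq hnd hlen hout hfresh
    obtain ⟨x, q, rfl⟩ : ∃ x r, q = x :: r := List.exists_cons_of_length_eq_add_one hq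
    have hql : q.length = n + 1 := by simpa using hq
    have hxP : x ∉ P := by simp [List.nodup_append] at hnd; grind
    have hxq : x ∉ q := by simp [List.nodup_append] at hnd; grind
    have hPq : ∀ z ∈ q, z ∉ P := by simp [List.nodup_append] at hnd; grind
    have hm : P.length + n + 2 + S.length = m := by
      rw [← hlen]; simp; omega
    -- the subsets containing `x`
    obtain ⟨q₁, s₁, hp₁, hg₁, hU₁⟩ := ih (q.length + ((Rseq (n + 1)).length + f))
      (P ++ [x]) q S seen hql (by simpa using hnd) (by simpa using hlen)
      (by
        intro q' i hq' hi him
        have := hout (x :: q') i (hq'.cons x) (by simp at hi ⊢; omega) him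
        simpa using this)
      (by
        intro T hT
        have hxT : x ∉ T := fun h => hxq (by simpa using hT h)
        have h := hfresh (insert x T) (by
          rw [List.toFinset_cons]; exact Finset.insert_subset_insert _ hT)
        have e : (P ++ [x]).toFinset ∪ T = P.toFinset ∪ insert x T := by
          ext z; simp
        rw [e, h]
        constructor
        · rintro ⟨c, hc, hce⟩
          cases c with
          | nil => simp at hce
          | cons y c =>
            obtain ⟨rfl, hcq⟩ := List.cons_prefix_cons.1 hc
            refine ⟨c, hcq, ?_⟩
            have hyc : y ∉ c.toFinset := fun h => hxq (hcq.subset (List.mem_toFinset.1 h))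
            rw [List.toFinset_cons] at hce
            rw [← Finset.erase_insert hxT, hce, Finset.erase_insert hyc]
        · rintro ⟨c, hc, rfl⟩
          exact ⟨x :: c, List.cons_prefix_cons.2 ⟨rfl, hc⟩, by simp⟩)
    have hl₁ : q₁.length = q.length := hp₁.length_eq
    have hf₁ : q₁.toFinset = q.toFinset := List.toFinset_eq_of_perm _ _ hp₁
    have hx₁ : ∀ T ⊆ q.toFinset, P.toFinset ∪ insert x T ∈ s₁ := by
      intro T hT
      refine (hU₁ _).2 (Or.inr ⟨T, hT, ?_⟩)
      ext z; simp
    have hmem₁ : ∀ T ⊆ q.toFinset, P.toFinset ∪ T ∈ s₁ ↔ T = ∅ := by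
      intro T hT
      have hxT : x ∉ T := fun h => hxq (by simpa using hT h)
      rw [hU₁, hfresh T (hT.trans (by rw [List.toFinset_cons]; exact Finset.subset_insert _ _))]
      constructor
      · rintro (⟨c, hc, rfl⟩ | ⟨T', _, h⟩)
        · cases c with
          | nil => rfl
          | cons y c =>
            obtain ⟨rfl, -⟩ := List.cons_prefix_cons.1 hc
            simp at hxT
        · have : x ∈ P.toFinset ∪ T := by rw [h]; simp
          simp [hxP, hxT] at this
      · rintro rfl
        exact Or.inl ⟨[], List.nil_prefix, rfl⟩
    have hcancel : ∀ T ⊆ q.toFinset, ∀ T' ⊆ q.toFinset,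
        P.toFinset ∪ T = P.toFinset ∪ T' → T = T' := by
      intro T hT T' hT' h
      ext z
      have hz := Finset.ext_iff.1 h z
      have h1 := @hT z
      have h2 := @hT' z
      have h3 := hPq z
      simp at hz h1 h2
      tauto
    have hpref : ∀ c, c <+: q₁ → c.toFinset ⊆ q.toFinset := by
      intro c hc z hz
      rw [← hf₁]
      simpa using hc.subset (by simpa using hz)
    -- moving `x` to the end of the window
    obtain ⟨s₂, hg₂, hU₂⟩ := greedyAux_sweep m x ((Rseq (n + 1)).length + f) S q₁ P s₁
      (by
        refine (List.Perm.nodup_iff ?_).1 hnd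
        exact ((hp₁.symm.cons x).append_left P).append_right S)
      (by simp; omega)
      (by rw [hf₁]; exact hx₁)
      (by
        intro b₁ b₂ i hb hi him
        refine (hU₁ _).2 (Or.inl ?_)
        have hp : (b₁ ++ x :: b₂).Perm (x :: q) := by
          refine List.perm_middle.trans ((List.Perm.cons x) ?_)
          rw [← hb]; exact hp₁
        have := hout _ i hp (by simp; omega) him
        simpa using this)
      (by
        intro c hc hne hmem
        rw [hmem₁ _ (hpref c hc)] at hmem
        exact hne (by simpa using hmem))
    -- the subsets avoiding `x`
    obtain ⟨q₃, s₃, hp₃, hg₃, hU₃⟩ := ih f P q₁ (x :: S) s₂ (by omega)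
      (by
        refine (List.Perm.nodup_iff ?_).1 hnd
        simp only [List.append_assoc, List.cons_append]
        refine List.Perm.append_left P ?_
        exact ((hp₁.symm.append_right S).cons x).trans List.perm_middle.symm)
      (by simp; omega)
      (by
        intro q' i hq' hi him
        refine (hU₂ _).2 (Or.inl ?_)
        by_cases hi' : P.length + (x :: q).length ≤ i
        · refine (hU₁ _).2 (Or.inl ?_)
          have hp : (q' ++ [x]).Perm (x :: q) :=
            (List.perm_append_singleton x q').trans ((hq'.trans hp₁).cons x)
          simpa using hout _ i hp hi' him
        · have hie : i = P.length + q'.length := by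
            rw [hq'.length_eq]
            simp at hi'
            omega
          rcases List.eq_nil_or_concat q' with h | ⟨r, y, h⟩
          · rw [h] at hq'
            have := hq'.length_eq
            simp at this
            omega
          · rw [List.concat_eq_append] at h
            have key := prefixSet_swapAdj (P ++ r) S y x
            have hl : (P ++ r).length + 1 = i := by rw [hie, h]; simp; omega
            have hc : P ++ q' ++ x :: S = P ++ r ++ y :: x :: S := by rw [h]; simp
            rw [hl] at key
            rw [hc, key]
            have := hx₁ r.toFinset (by
              rw [← hf₁, ← List.toFinset_eq_of_perm _ _ hq', h]
              intro z; simp; tauto)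
            convert this using 1
            ext z; simp)
      (by
        intro T hT
        rw [hf₁] at hT
        rw [hU₂, hmem₁ T hT]
        constructor
        · rintro (rfl | ⟨c, hc, _, h⟩)
          · exact ⟨[], List.nil_prefix, rfl⟩
          · exact ⟨c, hc, hcancel _ hT _ (hpref c hc) h⟩
        · rintro ⟨c, hc, rfl⟩
          by_cases hne : c = []
          · exact Or.inl (by simp [hne])
          · exact Or.inr ⟨c, hc, hne, rfl⟩)
    refine ⟨q₃ ++ [x], s₃, ?_, ?_, fun U => ?_⟩
    · exact (List.perm_append_singleton x q₃).trans ((hp₃.trans hp₁).cons x)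
    · have hL : (Rseq (n + 1 + 1)).length + f =
          (Rseq (n + 1)).length + (q.length + ((Rseq (n + 1)).length + f)) := by
        rw [Rseq_add_two]; simp; omega
      have e₁ : P ++ x :: q ++ S = P ++ [x] ++ q ++ S := by simp
      have e₂ : P ++ [x] ++ q₁ ++ S = P ++ x :: q₁ ++ S := by simp
      have e₃ : P ++ (q₃ ++ [x]) ++ S = P ++ q₃ ++ x :: S := by simp
      rw [hL, e₁, hg₁, e₂, ← hl₁, hg₂, hg₃, e₃, Rseq_add_two, hl₁, hql]
      simp [Function.comp_def, add_comm, add_left_comm]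
    · rw [hU₃, hU₂, hU₁, hf₁]
      constructor
      · rintro (((h | ⟨T, hT, rfl⟩) | ⟨c, hc, -, rfl⟩) | ⟨T, hT, rfl⟩)
        · exact Or.inl h
        · refine Or.inr ⟨insert x T, ?_, ?_⟩
          · rw [List.toFinset_cons]; exact Finset.insert_subset_insert _ hT
          · ext z; simp
        · refine Or.inr ⟨c.toFinset, (hpref c hc).trans ?_, rfl⟩
          rw [List.toFinset_cons]; exact Finset.subset_insert _ _
        · refine Or.inr ⟨T, hT.trans ?_, rfl⟩
          rw [List.toFinset_cons]; exact Finset.subset_insert _ _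
      · rintro (h | ⟨T, hT, rfl⟩)
        · exact Or.inl (Or.inl (Or.inl h))
        · rw [List.toFinset_cons] at hT
          by_cases hxT : x ∈ T
          · refine Or.inl (Or.inl (Or.inr ⟨T.erase x, ?_, ?_⟩))
            · exact Finset.subset_insert_iff.1 hT
            · rw [← Finset.insert_erase hxT]
              ext z; simp
          · exact Or.inr ⟨T, (Finset.subset_insert_iff_of_notMem hxT).1 hT, rfl⟩

lemma length_Rseq_le (n : ℕ) : (Rseq (n + 1)).length + n + 2 ≤ 2 ^ (n + 1) := by
  induction n with
  | zero => simp [Rseq]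
  | succ n ih =>
    rw [Rseq_add_two, pow_succ]
    simp
    omega

/-- Theorem 3.1: the greedy method produces exactly the sequence `R_m`. -/
theorem greedy_eq_Rseq (m : ℕ) (hm : 2 ≤ m) : greedySeq m = Rseq m := by
  obtain ⟨n, rfl⟩ : ∃ n, m = n + 1 := ⟨m - 1, by omega⟩
  have hlen : (initConfig (n + 1)).length = n + 1 := by simp [initConfig]
  have hnd : (initConfig (n + 1)).Nodup :=
    List.nodup_range.map (add_left_injective 1)
  obtain ⟨q', seen', hp, hg, hU⟩ := greedyAux_window (n + 1) n
    (2 ^ (n + 1) - (Rseq (n + 1)).length) [] (initConfig (n + 1)) []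
    (initSets (n + 1)).toFinset hlen (by simpa using hnd) (by simpa using hlen)
    (by
      intro q' i _ hi him
      simp [hlen] at hi
      omega)
    (by
      intro T _
      simp only [initSets, List.mem_toFinset, List.mem_map, List.mem_range, List.toFinset_nil,
        Finset.empty_union, prefixSet]
      constructor
      · rintro ⟨k, -, rfl⟩
        exact ⟨_, List.take_prefix _ _, rfl⟩
      · rintro ⟨c, hc, rfl⟩
        refine ⟨c.length, ?_, ?_⟩
        · have := hc.length_le
          omega
        · rw [← List.prefix_iff_eq_take.1 hc])
  have hR := length_Rseq_le n
  rw [Nat.add_sub_of_le (by omega)] at hg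
  simp only [List.nil_append, List.append_nil, List.length_nil, add_zero, List.map_id'] at hg
  rw [greedySeq, hg, greedyAux_eq_nil, List.append_nil]
  intro i hi him
  refine (hU _).2 (Or.inr ⟨_, ?_, by simp; rfl⟩)
  obtain ⟨A, x, y, B, hA, rfl⟩ := exists_eq_append_cons_cons q' hi
    (by rw [hp.length_eq, hlen]; exact him)
  rw [← List.toFinset_eq_of_perm _ _ hp, hA, prefixSet_swapAdj]
  intro z
  simp
  tauto
end

section
/- For every m ≥ 2, R_m equals the concatenation over c = 1, 2, …, 2^{m−1} − 1 of the blocks [d_c, d_c + 1, …, d_c + v_2(c)], where d_c = m − v_2(c) − HW(c). -/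
open List

theorem sum_digits_two_mul (c : ℕ) : (Nat.digits 2 (2 * c)).sum = (Nat.digits 2 c).sum := by
  rcases Nat.eq_zero_or_pos c with rfl | hc
  · simp
  · simp [Nat.digits_base_mul one_lt_two hc]

theorem sum_digits_two_mul_add_one (c : ℕ) :
    (Nat.digits 2 (2 * c + 1)).sum = (Nat.digits 2 c).sum + 1 := by
  rw [Nat.digits_def' one_lt_two (by omega), List.sum_cons]
  have h₁ : (2 * c + 1) % 2 = 1 := by omega
  have h₂ : (2 * c + 1) / 2 = c := by omega
  rw [h₁, h₂, add_comm]

theorem padicValNat_two_mul {c : ℕ} (hc : c ≠ 0) :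
    padicValNat 2 (2 * c) = padicValNat 2 c + 1 := by
  rw [padicValNat.mul two_ne_zero hc, padicValNat_self, add_comm]

theorem padicValNat_two_mul_add_one (c : ℕ) : padicValNat 2 (2 * c + 1) = 0 :=
  padicValNat.eq_zero_of_not_dvd (by omega)

theorem sum_digits_two_pow_add {n c : ℕ} (hc : c < 2 ^ n) :
    (Nat.digits 2 (2 ^ n + c)).sum = (Nat.digits 2 c).sum + 1 := by
  induction n generalizing c with
  | zero =>
    obtain rfl : c = 0 := by simpa using hc
    simp
  | succ n ih =>
    rw [pow_succ'] at hc ⊢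
    rcases Nat.even_or_odd' c with ⟨k, rfl | rfl⟩
    · rw [← mul_add, sum_digits_two_mul, sum_digits_two_mul, ih (by omega)]
    · rw [← add_assoc, ← mul_add, sum_digits_two_mul_add_one, sum_digits_two_mul_add_one,
        ih (by omega)]

theorem padicValNat_two_pow_add {n c : ℕ} (hc₀ : c ≠ 0) (hc : c < 2 ^ n) :
    padicValNat 2 (2 ^ n + c) = padicValNat 2 c := by
  induction n generalizing c with
  | zero => exact absurd (by simpa using hc) hc₀
  | succ n ih =>
    rw [pow_succ'] at hc ⊢
    rcases Nat.even_or_odd' c with ⟨k, rfl | rfl⟩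
    · rw [← mul_add, padicValNat_two_mul (by omega), padicValNat_two_mul (by omega),
        ih (by omega) (by omega)]
    · rw [← add_assoc, ← mul_add, padicValNat_two_mul_add_one, padicValNat_two_mul_add_one]

theorem padicValNat_two_add_sum_digits_le {n c : ℕ} (hc : c < 2 ^ n) :
    padicValNat 2 c + (Nat.digits 2 c).sum ≤ n := by
  induction n generalizing c with
  | zero =>
    obtain rfl : c = 0 := by simpa using hc
    simp
  | succ n ih =>
    rw [pow_succ'] at hc
    rcases Nat.even_or_odd' c with ⟨k, rfl | rfl⟩
    · rcases eq_or_ne k 0 with rfl | hk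
      · simp
      · have := ih (c := k) (by omega)
        rw [padicValNat_two_mul hk, sum_digits_two_mul]
        omega
    · have := ih (c := k) (by omega)
      rw [padicValNat_two_mul_add_one, sum_digits_two_mul_add_one]
      omega

/-- Theorem 4.1: `R_m` equals the concatenation over `c = 1, …, 2^(m-1) - 1` of the
blocks `[d_c, d_c + 1, …, d_c + v₂(c)]`, where `d_c = m - v₂(c) - HW(c)`, `v₂` is the
2-adic valuation and `HW` is the Hamming weight. -/
theorem Rseq_eq_forc_loop (m : ℕ) (hm : 2 ≤ m) :
    Rseq m = (List.range (2 ^ (m - 1) - 1)).flatMap (fun k =>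
      let c := k + 1
      let v := padicValNat 2 c
      let h := (Nat.digits 2 c).sum
      (List.range (v + 1)).map (fun s => m - v - h + s)) := by
  induction m, hm using Nat.le_induction with
  | base => simp [Rseq]
  | succ m hm ih =>
    obtain ⟨n, rfl⟩ := Nat.exists_eq_add_of_le' hm
    have hpos : 0 < 2 ^ (n + 1) := by positivity
    have hsplit : 2 ^ (n + 2 + 1 - 1) - 1 = (2 ^ (n + 1) - 1 + 1) + (2 ^ (n + 1) - 1) := by
      rw [show n + 2 + 1 - 1 = n + 1 + 1 by omega, pow_succ' 2 (n + 1)]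
      omega
    rw [show n + 2 - 1 = n + 1 by omega] at ih
    rw [hsplit, List.range_add, List.range_succ, List.flatMap_append, List.flatMap_append, Rseq,
      ih]
    congr 1
    · congr 1
      · rw [List.map_flatMap]
        refine List.flatMap_congr fun k hk => ?_
        rw [List.mem_range] at hk
        have := padicValNat_two_add_sum_digits_le (n := n + 1) (c := k + 1) (by omega)
        rw [List.map_map]
        refine List.map_congr_left fun s _ => ?_
        simp only [Function.comp_apply]
        omega
      · have hd := sum_digits_two_pow_add hpos
        rw [add_zero, Nat.digits_zero, List.sum_nil, zero_add] at hd
        rw [List.flatMap_singleton, Nat.sub_add_cancel hpos]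
        simp only [padicValNat.prime_pow, hd]
        refine List.map_congr_left fun s _ => ?_
        omega
    · rw [List.flatMap_map]
      refine List.flatMap_congr fun k hk => ?_
      rw [List.mem_range] at hk
      have hc : 2 ^ (n + 1) - 1 + 1 + k + 1 = 2 ^ (n + 1) + (k + 1) := by omega
      simp only [hc]
      rw [padicValNat_two_pow_add (by omega) (by omega), sum_digits_two_pow_add (by omega)]
      refine List.map_congr_left fun s _ => ?_
      omega
end

section
/- For every m ≥ 2, define t_1 = m − 2 and t_{j+1} = t_j + v_2(j) − 1 for j ≥ 1. Then R_m equals the list [m−1] followed by the concatenation over j = 1, 2, …, 2^{m−2} − 1 of the blocks [t_j, t_j + 1, …, t_j + v_2(j) + 1] ++ [t_j + v_2(j)]; moreover the final value t_{2^{m−2}} equals 0. -/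
open List

/-- Adding `2 ^ n` to a positive `k < 2 ^ n` does not change the 2-adic valuation. -/
theorem padicValNat_two_pow_add_s10 {n k : ℕ} (hk : 0 < k) (hkn : k < 2 ^ n) :
    padicValNat 2 (2 ^ n + k) = padicValNat 2 k := by
  have h1 : padicValNat 2 k < n := by
    rw [← Nat.pow_lt_pow_iff_right (a := 2) (by norm_num)]
    exact (Nat.le_of_dvd hk pow_padicValNat_dvd).trans_lt hkn
  apply le_antisymm
  · by_contra! h
    have h2 : 2 ^ (padicValNat 2 k + 1) ∣ 2 ^ n + k :=
      (Nat.pow_dvd_pow 2 h).trans pow_padicValNat_dvd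
    exact pow_succ_padicValNat_not_dvd hk.ne'
      ((Nat.dvd_add_right (Nat.pow_dvd_pow 2 h1)).1 h2)
  · rw [← padicValNat_dvd_iff_le (by omega)]
    exact dvd_add (Nat.pow_dvd_pow 2 h1.le) pow_padicValNat_dvd

/-- The list `[a, a + 1, …, a + v + 1] ++ [a + v]`. -/
def forjBlock (a : ℤ) (v : ℕ) : List ℤ :=
  (List.range (v + 2)).map (fun s : ℕ => a + (s : ℤ)) ++ [a + (v : ℤ)]

theorem map_add_one_forjBlock (a : ℤ) (v : ℕ) :
    (forjBlock a v).map (· + 1) = forjBlock (a + 1) v := by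
  simp [forjBlock, Function.comp_def, add_right_comm]

theorem forjBlock_one (n : ℕ) :
    forjBlock 1 n = ((List.range (n + 2)).map (· + 1)).map (fun k : ℕ => (k : ℤ)) ++
      [(n : ℤ) + 1] := by
  simp [forjBlock, Function.comp_def, add_comm]

/-- Only the recurrence for `j < 2 ^ n` matters; this restriction makes the claim inductive. -/
theorem Rseq_add_two_eq (n : ℕ) (t : ℕ → ℤ) (ht1 : t 1 = n)
    (htrec : ∀ j, 1 ≤ j → j < 2 ^ n → t (j + 1) = t j + (padicValNat 2 j : ℤ) - 1) :
    (Rseq (n + 2)).map (fun k : ℕ => (k : ℤ)) = ((n : ℤ) + 1) ::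
      (List.range (2 ^ n - 1)).flatMap
        (fun k => forjBlock (t (k + 1)) (padicValNat 2 (k + 1))) ∧
    t (2 ^ n) = 0 := by
  induction n generalizing t with
  | zero => simp [Rseq, ht1]
  | succ n ih =>
    have hpos : 0 < 2 ^ n := by positivity
    have hpow : 2 ^ (n + 1) = 2 ^ n + 2 ^ n := by ring
    obtain ⟨hR₁, hend₁⟩ := ih (fun j => t j - 1) (by simp [ht1]) (fun j h1 h2 => by
      rw [htrec j h1 (by omega)]; ring)
    have hmid : t (2 ^ n) = 1 := by linarith
    obtain ⟨hR₂, hend₂⟩ := ih (fun j => t (2 ^ n + j))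
      (by rw [htrec _ hpos (by omega), hmid]; simp)
      (fun j h1 h2 => by
        rw [← add_assoc, htrec _ (by omega) (by omega), padicValNat_two_pow_add_s10 h1 h2])
    refine ⟨?_, by rw [hpow]; exact hend₂⟩
    have hR₁' : ((Rseq (n + 2)).map (· + 1 : ℕ → ℕ)).map (fun k : ℕ => (k : ℤ)) = ((n : ℤ) + 1 + 1) ::
        (List.range (2 ^ n - 1)).flatMap
          (fun k => forjBlock (t (k + 1)) (padicValNat 2 (k + 1))) := by
      have := congrArg (List.map (· + (1 : ℤ))) hR₁
      simpa [List.map_flatMap, map_add_one_forjBlock, Function.comp_def] using this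
    have hsplit : 2 ^ (n + 1) - 1 = (2 ^ n - 1) + 1 + (2 ^ n - 1) := by omega
    have hR₂' : (List.range (2 ^ n - 1)).flatMap
          (fun k => forjBlock (t (2 ^ n + (k + 1))) (padicValNat 2 (k + 1))) =
        (List.range (2 ^ n - 1)).flatMap
          (fun k => forjBlock (t (2 ^ n + k + 1)) (padicValNat 2 (2 ^ n + k + 1))) := by
      refine List.flatMap_congr fun k hk => ?_
      rw [List.mem_range] at hk
      rw [add_assoc, padicValNat_two_pow_add_s10 k.succ_pos (by omega)]
    rw [hsplit, List.range_add, List.range_succ, Nat.sub_add_cancel hpos]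
    simp only [List.flatMap_append, List.flatMap_map, List.flatMap_singleton]
    rw [Nat.sub_add_cancel hpos, hmid, padicValNat.prime_pow, forjBlock_one, ← hR₂', Rseq,
      List.map_append, List.map_append, hR₁', hR₂]
    simp

/-- Theorem 5.1: with `t 1 = m - 2` and `t (j+1) = t j + v₂(j) - 1`, the sequence `R_m`
equals `[m-1]` followed by the concatenation over `j = 1, …, 2^(m-2) - 1` of the blocks
`[t_j, t_j + 1, …, t_j + v₂(j) + 1] ++ [t_j + v₂(j)]`; moreover `t (2^(m-2)) = 0`. -/
theorem Rseq_eq_forj_loop (m : ℕ) (hm : 2 ≤ m) (t : ℕ → ℤ)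
    (ht1 : t 1 = (m : ℤ) - 2)
    (htrec : ∀ j, 1 ≤ j → t (j + 1) = t j + (padicValNat 2 j : ℤ) - 1) :
    (Rseq m).map (fun n => (n : ℤ)) =
      ((m : ℤ) - 1) :: (List.range (2 ^ (m - 2) - 1)).flatMap (fun k =>
        let j := k + 1
        let v := padicValNat 2 j
        ((List.range (v + 2)).map (fun s => t j + (s : ℤ))) ++ [t j + (v : ℤ)]) ∧
    t (2 ^ (m - 2)) = 0 := by
  obtain ⟨n, rfl⟩ := Nat.exists_eq_add_of_le' hm
  have h := Rseq_add_two_eq n t (by rw [ht1]; push_cast; ring) (fun j h1 _ => htrec j h1)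
  have hn : ((n + 2 : ℕ) : ℤ) - 1 = n + 1 := by push_cast; ring
  rw [hn]
  simpa [forjBlock, List.map_flatMap, List.flatMap_singleton', ← List.map_eq_flatMap,
    Function.comp_def] using h
end
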